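/- Let 𝒯 and 𝒯' be staged trees such that the algebras im φ_𝒯 and im φ_{𝒯'} are equal, or differ only by a permutation of the label variables. Then 𝒯 and 𝒯' are simultaneously toric or non-toric: ker φ_𝒯 is generated by binomials after a linear change of coordinates if and only if ker φ_{𝒯'} is. -/

import Mathlib

noncomputable section
open scoped Classical
open MvPolynomial

/-- A staged tree: a finite rooted tree with edges directed away from the root,
each non-root vertex `c` carrying the label `label c` of the edge from `parent c` to `c`;
labels of outgoing edges of a vertex are pairwise distinct, and the outgoing label sets
of two vertices are either equal (same stage) or disjoint. -/
structure StagedTree (Θ : Type) [DecidableEq Θ] : Type 1 where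
  V : Type
  fintypeV : Fintype V
  decEqV : DecidableEq V
  root : V
  parent : V → V
  label : V → Θ
  parent_root : parent root = root
  reaches_root : ∀ v : V, ∃ n : ℕ, parent^[n] v = root
  label_inj : ∀ u v : V, u ≠ root → v ≠ root → parent u = parent v → label u = label v → u = v
  stage_disjoint : ∀ u v : V,
    (∀ θ : Θ, (∃ c, c ≠ root ∧ parent c = u ∧ label c = θ) ↔
        (∃ c, c ≠ root ∧ parent c = v ∧ label c = θ)) ∨
    (∀ θ : Θ, ¬((∃ c, c ≠ root ∧ parent c = u ∧ label c = θ) ∧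
        (∃ c, c ≠ root ∧ parent c = v ∧ label c = θ)))

namespace StagedTree

attribute [instance] StagedTree.fintypeV StagedTree.decEqV

variable {Θ : Type} [DecidableEq Θ] (T : StagedTree Θ)

/-- `c` is a child of `v`. -/
def IsChild (v c : T.V) : Prop := c ≠ T.root ∧ T.parent c = v

/-- `v` is a leaf (no children). -/
def IsLeaf (v : T.V) : Prop := ∀ c, ¬ T.IsChild v c

/-- `w` lies in the subtree rooted at `v` (i.e. `v` is an ancestor of `w` or `w` itself). -/
def Desc (v w : T.V) : Prop := ∃ n : ℕ, T.parent^[n] w = v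

/-- Distance of `v` from the root. -/
def depthOf (v : T.V) : ℕ := Nat.find (T.reaches_root v)

/-- The depth `d` of the tree: maximal number of edges on a root-to-leaf path. -/
def depth : ℕ := Finset.univ.sup T.depthOf

/-- The type of leaves of `T`. -/
def Leaf : Type := {v : T.V // T.IsLeaf v}

instance : Fintype T.Leaf := Subtype.fintype _

/-- Product of the labels along the root-to-`v` path, in `ℝ[Θ]`. -/
def pathProd (v : T.V) : MvPolynomial Θ ℝ :=
  ∏ i ∈ Finset.range (T.depthOf v), X (T.label (T.parent^[i] v))

/-- Homogenised root-to-`v` path monomial `z^(d - d(λ)) ∏ θ(e)` in `ℝ[Θ, z]`,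
where the variable `none` plays the role of `z`. -/
def hpm (v : T.V) : MvPolynomial (Option Θ) ℝ :=
  (X none) ^ (T.depth - T.depthOf v) *
    ∏ i ∈ Finset.range (T.depthOf v), X (some (T.label (T.parent^[i] v)))

/-- The ideal `⟨θ - z⟩` of homogenised local sum-to-one conditions. -/
def sumIdeal : Ideal (MvPolynomial (Option Θ) ℝ) :=
  Ideal.span {f | ∃ v : T.V, ¬ T.IsLeaf v ∧
    f = (∑ c ∈ Finset.univ.filter (fun c => T.IsChild v c), X (some (T.label c))) - X none}

/-- The homogenised parametrisation `φ_T : ℝ[p] → ℝ[Θ, z]/⟨θ - z⟩`. -/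
def phi : MvPolynomial T.Leaf ℝ →ₐ[ℝ] MvPolynomial (Option Θ) ℝ ⧸ T.sumIdeal :=
  aeval (fun l : T.Leaf => Ideal.Quotient.mk T.sumIdeal (T.hpm l.1))

/-- The ideal `⟨θ - 1⟩` of local sum-to-one conditions. -/
def oneIdeal : Ideal (MvPolynomial Θ ℝ) :=
  Ideal.span {f | ∃ v : T.V, ¬ T.IsLeaf v ∧
    f = (∑ c ∈ Finset.univ.filter (fun c => T.IsChild v c), X (T.label c)) - 1}

/-- The (non-homogenised) parametrisation `φ_T : ℝ[p] → ℝ[Θ]/⟨θ - 1⟩`. -/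
def phi1 : MvPolynomial T.Leaf ℝ →ₐ[ℝ] MvPolynomial Θ ℝ ⧸ T.oneIdeal :=
  aeval (fun l : T.Leaf => Ideal.Quotient.mk T.oneIdeal (T.pathProd l.1))

/-- The subtree polynomial `t(v)`: sum over all `v`-to-leaf paths of the products of
edge labels along the path. -/
def tpoly (v : T.V) : MvPolynomial Θ ℝ :=
  ∑ l ∈ Finset.univ.filter (fun w => T.IsLeaf w ∧ T.Desc v w),
    ∏ i ∈ Finset.range (T.depthOf l - T.depthOf v), X (T.label (T.parent^[i] l))

/-- Two non-leaf vertices are in the same stage when their outgoing label sets coincide. -/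
def SameStage (u v : T.V) : Prop :=
  ¬ T.IsLeaf u ∧ ¬ T.IsLeaf v ∧
    ∀ θ : Θ, (∃ c, T.IsChild u c ∧ T.label c = θ) ↔ (∃ c, T.IsChild v c ∧ T.label c = θ)

/-- `T` is balanced: `t(u_i)·t(v_j) = t(u_j)·t(v_i)` for all `u ∼ v` and all pairs of
children matched via the common labels. -/
def Balanced : Prop :=
  ∀ u v ui uj vi vj : T.V, T.SameStage u v →
    T.IsChild u ui → T.IsChild u uj → T.IsChild v vi → T.IsChild v vj →
    T.label ui = T.label vi → T.label uj = T.label vj →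
    T.tpoly ui * T.tpoly vj = T.tpoly uj * T.tpoly vi

/-- `p_{[v]}`: sum of the variables `p_r` over root-to-leaf paths through `v`. -/
def pSum (v : T.V) : MvPolynomial T.Leaf ℝ :=
  ∑ l ∈ Finset.univ.filter (fun l : T.Leaf => T.Desc v l.1), X l

/-- `T` has toric structure: there are linearly independent linear forms in which
`ker φ_T` is generated by binomials. -/
def Toric : Prop :=
  ∃ L : T.Leaf → MvPolynomial T.Leaf ℝ,
    (∀ i, (L i).IsHomogeneous 1) ∧ LinearIndependent ℝ L ∧
    ∃ B : Set (MvPolynomial T.Leaf ℝ),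
      (∀ f ∈ B, ∃ a b : T.Leaf → ℕ, f = (∏ i, L i ^ a i) - (∏ i, L i ^ b i)) ∧
      RingHom.ker T.phi.toRingHom = Ideal.span B

end StagedTree

section BinomialKernel

variable {ι κ A : Type*} [CommRing A] [Algebra ℝ A]

/-- The binomials `X^a - X^b`. -/
def binomials (ι : Type*) : Set (MvPolynomial ι ℝ) :=
  {f | ∃ a b : ι →₀ ℕ, f = monomial a 1 - monomial b 1}

/-- The ideal of relations of the family `x` is generated by binomials. -/
def HasBinomialKernel (x : ι → A) : Prop :=
  ∃ B ⊆ binomials ι, RingHom.ker (aeval x : MvPolynomial ι ℝ →ₐ[ℝ] A) = Ideal.span B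

/-- The ideal of relations of the family `x` is generated by binomials in some linearly
independent linear forms. -/
def IsToricFamily [Fintype ι] (x : ι → A) : Prop :=
  ∃ L : ι → MvPolynomial ι ℝ, (∀ i, (L i).IsHomogeneous 1) ∧ LinearIndependent ℝ L ∧
    ∃ B : Set (MvPolynomial ι ℝ),
      (∀ f ∈ B, ∃ a b : ι → ℕ, f = (∏ i, L i ^ a i) - (∏ i, L i ^ b i)) ∧
      RingHom.ker (aeval x : MvPolynomial ι ℝ →ₐ[ℝ] A) = Ideal.span B

lemma span_range_eq_span_range_X [Finite ι] {L : ι → MvPolynomial ι ℝ}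
    (hL : ∀ i, (L i).IsHomogeneous 1) (hli : LinearIndependent ℝ L) :
    Submodule.span ℝ (Set.range L) =
      Submodule.span ℝ (Set.range (X : ι → MvPolynomial ι ℝ)) := by
  have := Fintype.ofFinite ι
  have : FiniteDimensional ℝ (Submodule.span ℝ (Set.range (X : ι → MvPolynomial ι ℝ))) :=
    FiniteDimensional.span_of_finite ℝ (Set.finite_range _)
  refine Submodule.eq_of_le_of_finrank_eq ?_ ?_
  · rw [← homogeneousSubmodule_one_eq_span_X, Submodule.span_le]
    rintro _ ⟨i, rfl⟩
    exact hL i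
  · rw [finrank_span_eq_card hli, finrank_span_eq_card (linearIndependent_X ι ℝ)]

/-- Two linear maps from the same finite-dimensional space with the same range differ by an
automorphism of the source. -/
lemma exists_linearEquiv_comp_eq {K V E : Type*} [Field K] [AddCommGroup V] [Module K V]
    [FiniteDimensional K V] [AddCommGroup E] [Module K E] (F G : V →ₗ[K] E)
    (h : LinearMap.range F = LinearMap.range G) : ∃ M : V ≃ₗ[K] V, ∀ v, F (M v) = G v := by
  have key (F : V →ₗ[K] E) : ∃ e : V ≃ₗ[K] LinearMap.range F × LinearMap.ker F,
      ∀ v, ((e v).1 : E) = F v := by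
    obtain ⟨q, hq⟩ := (LinearMap.ker F).exists_isCompl
    have hr : LinearMap.ker F.rangeRestrict = LinearMap.ker F := LinearMap.ker_rangeRestrict F
    refine ⟨LinearMap.equivProdOfSurjectiveOfIsCompl F.rangeRestrict
      ((LinearMap.ker F).projectionOnto q hq) (LinearMap.range_rangeRestrict F)
      (Submodule.range_projectionOnto hq) ?_, fun v ↦ rfl⟩
    rw [Submodule.ker_projectionOnto, hr]
    exact hq
  obtain ⟨e, he⟩ := key F
  obtain ⟨e', he'⟩ := key G
  have hk : Module.finrank K (LinearMap.ker G) = Module.finrank K (LinearMap.ker F) := by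
    have h1 := LinearMap.finrank_range_add_finrank_ker F
    have h2 := LinearMap.finrank_range_add_finrank_ker G
    rw [h] at h1
    omega
  refine ⟨e' ≪≫ₗ (LinearEquiv.prodCongr (LinearEquiv.ofEq _ _ h.symm)
    (LinearEquiv.ofFinrankEq _ _ hk)) ≪≫ₗ e.symm, fun v ↦ ?_⟩
  rw [← he, ← he']
  simp

lemma exists_linearForms_aeval_eq [Finite ι] (x y : ι → A)
    (h : Submodule.span ℝ (Set.range x) = Submodule.span ℝ (Set.range y)) :
    ∃ L : ι → MvPolynomial ι ℝ, (∀ i, (L i).IsHomogeneous 1) ∧ LinearIndependent ℝ L ∧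
      ∀ i, aeval x (L i) = y i := by
  obtain ⟨M, hM⟩ := exists_linearEquiv_comp_eq (Finsupp.linearCombination ℝ x)
    (Finsupp.linearCombination ℝ y)
    (by rw [Finsupp.range_linearCombination, Finsupp.range_linearCombination, h])
  let ℓ : (ι →₀ ℝ) →ₗ[ℝ] MvPolynomial ι ℝ := Finsupp.linearCombination ℝ X
  have hℓ (v : ι →₀ ℝ) : aeval x (ℓ v) = Finsupp.linearCombination ℝ x v := by
    simp only [ℓ, Finsupp.linearCombination_apply, Finsupp.sum, map_sum, map_smul, aeval_X]
  refine ⟨fun i ↦ ℓ (M (Finsupp.single i 1)), fun i ↦ ?_, ?_, fun i ↦ ?_⟩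
  · rw [← mem_homogeneousSubmodule, homogeneousSubmodule_one_eq_span_X,
      ← Finsupp.range_linearCombination]
    exact ⟨_, rfl⟩
  · have hb : LinearIndependent ℝ fun i : ι ↦ (Finsupp.single i 1 : ι →₀ ℝ) :=
      Finsupp.linearIndependent_single_one ℝ ι
    have hinj : LinearMap.ker (ℓ ∘ₗ M.toLinearMap) = ⊥ := by
      rw [LinearMap.ker_eq_bot, LinearMap.coe_comp]
      exact Function.Injective.comp (linearIndependent_X ι ℝ) M.injective
    exact hb.map' (ℓ ∘ₗ M.toLinearMap) hinj
  · rw [hℓ, hM, Finsupp.linearCombination_single, one_smul]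

lemma aeval_comp_aeval_eq (x : ι → A) (L : κ → MvPolynomial ι ℝ) :
    (aeval x).comp (aeval L) = aeval fun i ↦ aeval x (L i) := by
  ext i
  simp

lemma bijective_aeval_of_linearIndependent [Finite ι] {L : ι → MvPolynomial ι ℝ}
    (hL : ∀ i, (L i).IsHomogeneous 1) (hli : LinearIndependent ℝ L) :
    Function.Bijective (aeval L : MvPolynomial ι ℝ →ₐ[ℝ] MvPolynomial ι ℝ) := by
  have key {L : ι → MvPolynomial ι ℝ} (hL : ∀ i, (L i).IsHomogeneous 1)
      (hli : LinearIndependent ℝ L) : ∃ N : ι → MvPolynomial ι ℝ, (∀ i, (N i).IsHomogeneous 1) ∧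
        LinearIndependent ℝ N ∧ Function.LeftInverse (aeval L) (aeval N) := by
    obtain ⟨N, hN, hNli, h⟩ := exists_linearForms_aeval_eq L X (span_range_eq_span_range_X hL hli)
    refine ⟨N, hN, hNli, fun f ↦ ?_⟩
    have := DFunLike.congr_fun (aeval_comp_aeval_eq L N) f
    simpa only [h, aeval_X_left, AlgHom.comp_apply, AlgHom.id_apply] using this
  obtain ⟨N, hN, hNli, h⟩ := key hL hli
  obtain ⟨N', -, -, h'⟩ := key hN hNli
  rw [← h.eq_rightInverse h'.rightInverse] at h'
  exact ⟨h'.injective, h.surjective⟩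

lemma aeval_monomial_eq_prod [Fintype ι] (x : ι → A) (a : ι →₀ ℕ) :
    aeval x (monomial a (1 : ℝ)) = ∏ i, x i ^ a i := by
  rw [aeval_monomial, map_one, one_mul, Finsupp.prod_fintype _ _ fun _ ↦ pow_zero _]

/-- A family is toric exactly when an invertible linear change of the family has a binomial
ideal of relations. -/
lemma isToricFamily_iff [Fintype ι] (x : ι → A) :
    IsToricFamily x ↔ ∃ L : ι → MvPolynomial ι ℝ, (∀ i, (L i).IsHomogeneous 1) ∧
      LinearIndependent ℝ L ∧ HasBinomialKernel fun i ↦ aeval x (L i) := by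
  refine exists_congr fun L ↦ and_congr_right fun hL ↦ and_congr_right fun hli ↦ ?_
  let Λ := AlgEquiv.ofBijective (aeval L) (bijective_aeval_of_linearIndependent hL hli)
  have hmono (a : ι →₀ ℕ) : Λ (monomial a 1) = ∏ i, L i ^ a i := aeval_monomial_eq_prod L a
  have hker (f : MvPolynomial ι ℝ) :
      aeval x (Λ f) = aeval (fun i ↦ aeval x (L i)) f :=
    DFunLike.congr_fun (aeval_comp_aeval_eq x L) f
  have hcomap : RingHom.ker (aeval fun i ↦ aeval x (L i)) =
      (RingHom.ker (aeval x)).comap (Λ : MvPolynomial ι ℝ ≃+* MvPolynomial ι ℝ) := by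
    ext f
    simp [RingHom.mem_ker, ← hker f]
  constructor
  · rintro ⟨B, hB, hBker⟩
    refine ⟨Λ ⁻¹' B, fun f hf ↦ ?_, ?_⟩
    · obtain ⟨a, b, hab⟩ := hB _ hf
      refine ⟨Finsupp.equivFunOnFinite.symm a, Finsupp.equivFunOnFinite.symm b, Λ.injective ?_⟩
      simp only [map_sub, hmono, hab, Finsupp.equivFunOnFinite_symm_apply_apply]
    · rw [hcomap, hBker, ← Ideal.map_symm, Ideal.map_span]
      congr 1
      exact Λ.toEquiv.symm.image_eq_preimage_symm B
  · rintro ⟨B, hB, hBker⟩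
    refine ⟨Λ '' B, ?_, ?_⟩
    · rintro _ ⟨f, hf, rfl⟩
      obtain ⟨a, b, rfl⟩ := hB hf
      exact ⟨a, b, by simp only [map_sub, hmono]⟩
    · have := congrArg (Ideal.map (Λ : MvPolynomial ι ℝ ≃+* MvPolynomial ι ℝ)) (hcomap ▸ hBker)
      rw [Ideal.map_comap_of_surjective _ (RingEquiv.surjective _), Ideal.map_span] at this
      exact this

lemma span_range_aeval_of_linearIndependent [Finite ι] (x : ι → A) {L : ι → MvPolynomial ι ℝ}
    (hL : ∀ i, (L i).IsHomogeneous 1) (hli : LinearIndependent ℝ L) :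
    Submodule.span ℝ (Set.range fun i ↦ aeval x (L i)) = Submodule.span ℝ (Set.range x) := by
  have h := congrArg (Submodule.map (aeval x).toLinearMap) (span_range_eq_span_range_X hL hli)
  rw [Submodule.map_span, Submodule.map_span, ← Set.range_comp, ← Set.range_comp] at h
  have hX : (aeval x).toLinearMap ∘ (X : ι → MvPolynomial ι ℝ) = x := funext fun i ↦ aeval_X x i
  rw [hX] at h
  exact h

/-- Passing to the distinct nonzero members of a family in a domain keeps its ideal of relations
binomial. -/
lemma HasBinomialKernel.subtype_range [IsDomain A] {y : ι → A} (h : HasBinomialKernel y) :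
    HasBinomialKernel (Subtype.val : ↥(Set.range y \ {0}) → A) := by
  obtain ⟨B, hB, hker⟩ := h
  let p : ι → MvPolynomial ↥(Set.range y \ {0}) ℝ := fun i ↦
    if hi : y i = 0 then 0 else X ⟨y i, ⟨i, rfl⟩, hi⟩
  have hp (i : ι) : aeval (Subtype.val : ↥(Set.range y \ {0}) → A) (p i) = y i := by
    by_cases hi : y i = 0 <;> simp [p, hi]
  have hcomp (f : MvPolynomial ι ℝ) :
      aeval (Subtype.val : ↥(Set.range y \ {0}) → A) (aeval p f) = aeval y f := by
    have := DFunLike.congr_fun (aeval_comp_aeval_eq (κ := ι) (Subtype.val : ↥(Set.range y \ {0}) → A) p) f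
    rwa [AlgHom.comp_apply, funext hp] at this
  have hsurj : Function.Surjective (aeval p : MvPolynomial ι ℝ →ₐ[ℝ] _) := by
    rw [← AlgHom.range_eq_top, eq_top_iff, ← adjoin_range_X, Algebra.adjoin_le_iff]
    rintro _ ⟨⟨_, ⟨i, rfl⟩, hi⟩, rfl⟩
    exact ⟨X i, by simp [p, show y i ≠ 0 from hi]⟩
  have hmono (a : ι →₀ ℕ) : aeval y (monomial a (1 : ℝ)) ≠ 0 →
      ∃ c, aeval p (monomial a (1 : ℝ)) = monomial c 1 := by
    intro ha
    rw [aeval_monomial, map_one, one_mul, Finsupp.prod, Finset.prod_ne_zero_iff] at ha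
    refine ⟨∑ i : a.support, a i • Finsupp.single
      ⟨y i, ⟨i, rfl⟩, fun h0 ↦ ha i i.2 (by
        rw [Set.mem_singleton_iff.1 h0, zero_pow (Finsupp.mem_support_iff.1 i.2)])⟩ 1, ?_⟩
    rw [aeval_monomial, map_one, one_mul, Finsupp.prod, monomial_sum_one,
      ← Finset.prod_coe_sort]
    refine Finset.prod_congr rfl fun i _ ↦ ?_
    have hi : y i ≠ 0 := fun h0 ↦ ha i i.2 (by rw [h0, zero_pow (Finsupp.mem_support_iff.1 i.2)])
    simp only [p, dif_neg hi, X_pow_eq_monomial, Finsupp.smul_single, smul_eq_mul, mul_one]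
  have hmono0 (a : ι →₀ ℕ) : aeval y (monomial a (1 : ℝ)) = 0 →
      aeval p (monomial a (1 : ℝ)) = 0 := by
    intro ha
    rw [aeval_monomial, map_one, one_mul, Finsupp.prod, Finset.prod_eq_zero_iff] at ha
    obtain ⟨i, hi, h0⟩ := ha
    rw [aeval_monomial, map_one, one_mul, Finsupp.prod]
    refine Finset.prod_eq_zero hi ?_
    rw [show p i = 0 from dif_pos (eq_zero_of_pow_eq_zero h0),
      zero_pow (Finsupp.mem_support_iff.1 hi)]
  refine ⟨aeval p '' B, ?_, ?_⟩
  · rintro _ ⟨f, hf, rfl⟩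
    have hf0 : aeval y f = 0 := RingHom.mem_ker.1 (hker ▸ Ideal.subset_span hf)
    obtain ⟨a, b, rfl⟩ := hB hf
    rw [map_sub, sub_eq_zero] at hf0
    by_cases ha : aeval y (monomial a (1 : ℝ)) = 0
    · exact ⟨0, 0, by rw [map_sub, hmono0 a ha, hmono0 b (hf0 ▸ ha), sub_self, sub_self]⟩
    · obtain ⟨c, hc⟩ := hmono a ha
      obtain ⟨c', hc'⟩ := hmono b (hf0 ▸ ha)
      exact ⟨c, c', by rw [map_sub, hc, hc']⟩
  · refine le_antisymm (fun g hg ↦ ?_) (Ideal.span_le.2 ?_)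
    · obtain ⟨f, rfl⟩ := hsurj g
      have hf : f ∈ Ideal.span B := hker ▸ (RingHom.mem_ker.2 ((hcomp f).symm.trans hg))
      have := Ideal.mem_map_of_mem (aeval p : MvPolynomial ι ℝ →ₐ[ℝ] _) hf
      rwa [Ideal.map_span] at this
    · rintro _ ⟨f, hf, rfl⟩
      exact RingHom.mem_ker.2 ((hcomp f).trans (RingHom.mem_ker.1 (hker ▸ Ideal.subset_span hf)))

lemma HasBinomialKernel.comp_surjective {w : κ → A} (h : HasBinomialKernel w) {s : ι → κ}
    (hs : Function.Surjective s) : HasBinomialKernel (w ∘ s) := by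
  obtain ⟨B, hB, hker⟩ := h
  obtain ⟨t, ht⟩ := hs.hasRightInverse
  have hcomp (f : MvPolynomial ι ℝ) : aeval w (rename s f) = aeval (w ∘ s) f := aeval_rename s w f
  have hcomp' (f : MvPolynomial κ ℝ) : aeval (w ∘ s) (rename t f) = aeval w f := by
    rw [aeval_rename, Function.comp_assoc, ht.comp_eq_id, Function.comp_id]
  refine ⟨rename t '' B ∪ Set.range fun i ↦ X i - X (t (s i)), ?_, le_antisymm ?_ ?_⟩
  · rintro _ (⟨f, hf, rfl⟩ | ⟨i, rfl⟩)
    · obtain ⟨a, b, rfl⟩ := hB hf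
      exact ⟨a.mapDomain t, b.mapDomain t, by simp [rename_monomial]⟩
    · exact ⟨_, _, rfl⟩
  · intro f hf
    set I := Ideal.span (rename t '' B ∪ Set.range fun i ↦ (X i - X (t (s i)) : MvPolynomial ι ℝ))
    have h1 : rename t (rename s f) ∈ I := by
      have : rename s f ∈ Ideal.span B := hker ▸ RingHom.mem_ker.2 ((hcomp f).trans hf)
      have := Ideal.mem_map_of_mem (rename t : MvPolynomial κ ℝ →ₐ[ℝ] MvPolynomial ι ℝ) this
      rw [Ideal.map_span] at this
      exact Ideal.span_mono Set.subset_union_left this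
    have h2 : (Ideal.Quotient.mkₐ ℝ I).comp ((rename t).comp (rename s)) =
        Ideal.Quotient.mkₐ ℝ I := by
      ext i
      simp only [AlgHom.comp_apply, rename_X]
      have : (X i - X (t (s i)) : MvPolynomial ι ℝ) ∈ I := Ideal.subset_span (Or.inr ⟨i, rfl⟩)
      exact ((Ideal.Quotient.eq).2 this).symm
    have h3 : Ideal.Quotient.mk I (rename t (rename s f)) = Ideal.Quotient.mk I f :=
      DFunLike.congr_fun h2 f
    rw [Ideal.Quotient.eq_zero_iff_mem.2 h1] at h3
    exact Ideal.Quotient.eq_zero_iff_mem.1 h3.symm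
  · rw [Ideal.span_le]
    rintro _ (⟨f, hf, rfl⟩ | ⟨i, rfl⟩)
    · exact RingHom.mem_ker.2 ((hcomp' f).trans
        (RingHom.mem_ker.1 (hker ▸ Ideal.subset_span hf)))
    · exact RingHom.mem_ker.2 (by simp [ht (s i)])

lemma aeval_mem_span_range (x : ι → A) {f : MvPolynomial ι ℝ} (hf : f.IsHomogeneous 1) :
    aeval x f ∈ Submodule.span ℝ (Set.range x) := by
  rw [← mem_homogeneousSubmodule, homogeneousSubmodule_one_eq_span_X] at hf
  have := Submodule.mem_map_of_mem (f := (aeval x).toLinearMap) hf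
  rw [Submodule.map_span, ← Set.range_comp] at this
  have hX : (aeval x).toLinearMap ∘ (X : ι → MvPolynomial ι ℝ) = x := funext fun i ↦ aeval_X x i
  rwa [hX] at this

variable {σ : Type*} {d : ℕ}

/-- Distinct nonzero forms of the same positive degree with a binomial ideal of relations are
linearly independent. -/
lemma HasBinomialKernel.linearIndependent {w : ι → MvPolynomial σ ℝ} (h : HasBinomialKernel w)
    (hd : 0 < d) (hw : ∀ i, (w i).IsHomogeneous d) (hw0 : ∀ i, w i ≠ 0)
    (hinj : Function.Injective w) : LinearIndependent ℝ w := by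
  obtain ⟨B, hB, hker⟩ := h
  have hsq : Ideal.span B ≤ idealOfVars ι ℝ ^ 2 := by
    refine Ideal.span_le.2 fun f hf ↦ ?_
    have hf0 : aeval w f = 0 := RingHom.mem_ker.1 (hker ▸ Ideal.subset_span hf)
    obtain ⟨a, b, rfl⟩ := hB hf
    rw [map_sub, sub_eq_zero] at hf0
    have hne : aeval w (monomial a (1 : ℝ)) ≠ 0 := by
      rw [aeval_monomial, map_one, one_mul, Finsupp.prod, Finset.prod_ne_zero_iff]
      exact fun i _ ↦ pow_ne_zero _ (hw0 i)
    have hdeg : a.degree = b.degree := by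
      have ha := (isHomogeneous_monomial (1 : ℝ) (d := a) rfl).aeval w hw
      have hb := (isHomogeneous_monomial (1 : ℝ) (d := b) rfl).aeval w hw
      exact Nat.eq_of_mul_eq_mul_left hd (ha.inj_right (hf0 ▸ hb) hne)
    by_cases h2 : 2 ≤ a.degree
    · exact sub_mem ((monomial_mem_pow_idealOfVars_iff 2 a one_ne_zero).2 h2)
        ((monomial_mem_pow_idealOfVars_iff 2 b one_ne_zero).2 (hdeg ▸ h2))
    · suffices a = b by rw [this, sub_self]; exact zero_mem _
      obtain h0 | h1 : a.degree = 0 ∨ a.degree = 1 := by omega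
      · rw [(Finsupp.degree_eq_zero_iff a).1 h0, (Finsupp.degree_eq_zero_iff b).1 (hdeg ▸ h0)]
      · obtain ⟨i, rfl⟩ := (Finsupp.sum_eq_one_iff a).1 h1
        obtain ⟨k, rfl⟩ := (Finsupp.sum_eq_one_iff b).1 (hdeg.symm.trans h1)
        have hik : w i = w k := by
          rwa [show monomial (Finsupp.single i 1) (1 : ℝ) = X i from rfl, aeval_X,
            show monomial (Finsupp.single k 1) (1 : ℝ) = X k from rfl, aeval_X] at hf0
        rw [hinj hik]
  rw [linearIndependent_iff]
  intro l hl
  set f : MvPolynomial ι ℝ := Finsupp.linearCombination ℝ X l with hfdef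
  have hf1 : f.IsHomogeneous 1 := by
    rw [← mem_homogeneousSubmodule, homogeneousSubmodule_one_eq_span_X,
      ← Finsupp.range_linearCombination]
    exact ⟨l, rfl⟩
  have hfw : aeval w f = 0 := by
    rw [← hl, hfdef]
    simp only [Finsupp.linearCombination_apply, Finsupp.sum, map_sum, map_smul, aeval_X]
  have hf2 : f ∈ idealOfVars ι ℝ ^ 2 := hsq (hker ▸ RingHom.mem_ker.2 hfw)
  have hf0 : f = 0 := by
    ext a
    by_cases ha : a.degree = 1
    · exact (mem_pow_idealOfVars_iff' 2 f).1 hf2 a (by omega)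
    · exact hf1.coeff_eq_zero ha
  exact linearIndependent_iff.1 (linearIndependent_X ι ℝ) l hf0

/-- Being toric depends only on the linear span of a family of nonzero forms of the same positive
degree. -/
lemma isToricFamily_iff_exists_basis [Fintype ι] {x : ι → MvPolynomial σ ℝ} (hd : 0 < d)
    (hx : ∀ i, (x i).IsHomogeneous d) (hx0 : ∀ i, x i ≠ 0) :
    IsToricFamily x ↔ ∃ s : Set (MvPolynomial σ ℝ),
      LinearIndependent ℝ (Subtype.val : s → MvPolynomial σ ℝ) ∧
      Submodule.span ℝ s = Submodule.span ℝ (Set.range x) ∧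
      HasBinomialKernel (Subtype.val : s → MvPolynomial σ ℝ) := by
  rw [isToricFamily_iff]
  constructor
  · rintro ⟨L, hL, hli, hbin⟩
    refine ⟨_, hbin.subtype_range.linearIndependent hd ?_ (fun i ↦ i.2.2)
      Subtype.val_injective, ?_, hbin.subtype_range⟩
    · rintro ⟨_, ⟨i, rfl⟩, -⟩
      simpa using (hL i).aeval x hx
    · rw [Submodule.span_sdiff_singleton_zero, span_range_aeval_of_linearIndependent x hL hli]
  · rintro ⟨s, hs, hspan, hbin⟩
    have hle : Set.range (Subtype.val : s → MvPolynomial σ ℝ) ≤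
        Submodule.span ℝ (Set.range x) := by
      rw [Subtype.range_val, ← hspan]
      exact Submodule.subset_span
    have : Finite s := LinearIndependent.finite_of_le_span_finite _ hs _ hle
    have := Fintype.ofFinite s
    have hcard : Fintype.card s ≤ Fintype.card ι := by
      have h1 := linearIndependent_le_span' _ hs _ hle
      rw [Cardinal.mk_fintype, Nat.cast_le] at h1
      exact h1.trans (Fintype.card_range_le x)
    obtain ⟨t⟩ := Function.Embedding.nonempty_of_card_le hcard
    obtain ⟨r, hr⟩ : ∃ r : ι → s, Function.Surjective r := by
      rcases isEmpty_or_nonempty s with hs | hs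
      · have : IsEmpty ι := ⟨fun i ↦ hx0 i <| by
          have hi : x i ∈ Submodule.span ℝ s := hspan ▸ Submodule.subset_span ⟨i, rfl⟩
          rwa [Set.isEmpty_coe_sort.1 hs, Submodule.span_empty, Submodule.mem_bot] at hi⟩
        exact ⟨isEmptyElim, fun a ↦ isEmptyElim a⟩
      · exact ⟨Function.invFun t, Function.invFun_surjective t.injective⟩
    have hrange : Submodule.span ℝ (Set.range x) =
        Submodule.span ℝ (Set.range (Subtype.val ∘ r)) := by
      rw [hr.range_comp, Subtype.range_val, hspan]
    obtain ⟨L, hL, hli, h⟩ := exists_linearForms_aeval_eq x _ hrange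
    exact ⟨L, hL, hli, by rw [funext h]; exact hbin.comp_surjective hr⟩

lemma le_and_mem_span_of_mem_adjoin {x : ι → MvPolynomial σ ℝ} (hx : ∀ i, (x i).IsHomogeneous d)
    {f : MvPolynomial σ ℝ} {e : ℕ} (he : 0 < e) (hf : f.IsHomogeneous e) (hf0 : f ≠ 0)
    (hmem : f ∈ Algebra.adjoin ℝ (Set.range x)) :
    d ≤ e ∧ (e = d → f ∈ Submodule.span ℝ (Set.range x)) := by
  rw [Algebra.adjoin_range_eq_range_aeval] at hmem
  obtain ⟨g, hg⟩ := hmem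
  replace hg : aeval x g = f := hg
  have hsum : f = ∑ k ∈ Finset.range (g.totalDegree + 1),
      if e = d * k then aeval x (homogeneousComponent k g) else 0 := by
    conv_lhs => rw [← homogeneousComponent_eq_self hf, ← hg, ← sum_homogeneousComponent g,
      map_sum, map_sum]
    exact Finset.sum_congr rfl fun k _ ↦
      homogeneousComponent_of_mem ((homogeneousComponent_isHomogeneous k g).aeval x hx)
  constructor
  · by_contra hlt
    refine hf0 (hsum.trans (Finset.sum_eq_zero fun k _ ↦ if_neg fun hk ↦ hlt ?_))
    exact Nat.le_of_dvd he ⟨k, hk⟩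
  · rintro rfl
    rw [hsum]
    refine Submodule.sum_mem _ fun k _ ↦ ?_
    split_ifs with hk
    · obtain rfl : k = 1 := by simpa [he.ne'] using hk.symm
      exact aeval_mem_span_range x (homogeneousComponent_isHomogeneous 1 g)
    · exact zero_mem _

/-- Families of nonzero forms of positive degrees generating the same algebra span the same
space. -/
lemma span_range_eq_of_adjoin_eq [Nonempty ι] [Nonempty κ] {x : ι → MvPolynomial σ ℝ}
    {y : κ → MvPolynomial σ ℝ} {e : ℕ} (hd : 0 < d) (he : 0 < e)
    (hx : ∀ i, (x i).IsHomogeneous d) (hx0 : ∀ i, x i ≠ 0)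
    (hy : ∀ i, (y i).IsHomogeneous e) (hy0 : ∀ i, y i ≠ 0)
    (h : Algebra.adjoin ℝ (Set.range x) = Algebra.adjoin ℝ (Set.range y)) :
    d = e ∧ Submodule.span ℝ (Set.range x) = Submodule.span ℝ (Set.range y) := by
  have hxy (i : ι) := le_and_mem_span_of_mem_adjoin hy hd (hx i) (hx0 i)
    (h ▸ Algebra.subset_adjoin ⟨i, rfl⟩)
  have hyx (k : κ) := le_and_mem_span_of_mem_adjoin hx he (hy k) (hy0 k)
    (h ▸ Algebra.subset_adjoin ⟨k, rfl⟩)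
  have hde : d = e := le_antisymm (hyx (Classical.arbitrary κ)).1 (hxy (Classical.arbitrary ι)).1
  refine ⟨hde, le_antisymm (Submodule.span_le.2 ?_) (Submodule.span_le.2 ?_)⟩
  · rintro _ ⟨i, rfl⟩
    exact (hxy i).2 hde
  · rintro _ ⟨k, rfl⟩
    exact (hyx k).2 hde.symm

lemma eq_zero_of_adjoin_eq_of_isHomogeneous_zero [Nonempty κ] {x : ι → MvPolynomial σ ℝ}
    {y : κ → MvPolynomial σ ℝ} {e : ℕ} (hx : ∀ i, (x i).IsHomogeneous 0)
    (hy : ∀ i, (y i).IsHomogeneous e) (hy0 : ∀ i, y i ≠ 0)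
    (h : Algebra.adjoin ℝ (Set.range x) = Algebra.adjoin ℝ (Set.range y)) : e = 0 := by
  have hk : y (Classical.arbitrary κ) ∈ Algebra.adjoin ℝ (Set.range x) :=
    h ▸ Algebra.subset_adjoin ⟨_, rfl⟩
  rw [Algebra.adjoin_range_eq_range_aeval] at hk
  obtain ⟨g, hg⟩ := hk
  have h0 : (y (Classical.arbitrary κ)).IsHomogeneous 0 := by
    rw [← hg]
    change (aeval x g).IsHomogeneous 0
    rw [← sum_homogeneousComponent g, map_sum]
    exact IsHomogeneous.sum _ _ _ fun k _ ↦ by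
      simpa using (homogeneousComponent_isHomogeneous k g).aeval x hx
  exact (hy _).inj_right h0 (hy0 _)

lemma isToricFamily_one [Fintype ι] [Nontrivial A] : IsToricFamily (fun _ : ι ↦ (1 : A)) := by
  refine ⟨X, fun i ↦ isHomogeneous_X ℝ i, linearIndependent_X ι ℝ, Set.range fun i ↦ X i - 1,
    ?_, le_antisymm (fun f hf ↦ ?_) (Ideal.span_le.2 ?_)⟩
  · rintro _ ⟨i, rfl⟩
    exact ⟨Pi.single i 1, 0, by simp [Pi.single_apply, Finset.prod_ite_eq']⟩
  · set I := Ideal.span (Set.range fun i : ι ↦ (X i - 1 : MvPolynomial ι ℝ))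
    have h : (Algebra.ofId ℝ (MvPolynomial ι ℝ ⧸ I)).comp (aeval fun _ : ι ↦ (1 : ℝ)) =
        Ideal.Quotient.mkₐ ℝ I := by
      ext i
      have hi : (X i - 1 : MvPolynomial ι ℝ) ∈ I := Ideal.subset_span ⟨i, rfl⟩
      simpa using ((Ideal.Quotient.eq).2 hi).symm
    have h0 : aeval (fun _ : ι ↦ (1 : ℝ)) f = 0 := by
      have h1 : (Algebra.ofId ℝ A).comp (aeval fun _ : ι ↦ (1 : ℝ)) = aeval fun _ : ι ↦ (1 : A) := by
        ext i
        simp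
      refine FaithfulSMul.algebraMap_injective ℝ A ?_
      rw [map_zero, ← RingHom.mem_ker.1 hf]
      exact DFunLike.congr_fun h1 f
    have h1 := DFunLike.congr_fun h f
    rw [AlgHom.comp_apply, h0, map_zero] at h1
    exact Ideal.Quotient.eq_zero_iff_mem.1 h1.symm
  · rintro _ ⟨i, rfl⟩
    exact RingHom.mem_ker.2 (by simp)

end BinomialKernel

/-- Linear forms realising the quotient by sum-to-`z` relations over pairwise disjoint sets of
variables as a subalgebra of a polynomial ring. -/
lemma exists_aeval_ker_eq_span_sum_sub {Θ : Type*} (𝒮 : Set (Finset Θ))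
    (hne : ∀ S ∈ 𝒮, S.Nonempty)
    (hdisj : ∀ S ∈ 𝒮, ∀ S' ∈ 𝒮, ∀ θ ∈ S, θ ∈ S' → S = S') :
    ∃ g : Option Θ → MvPolynomial (Option Θ) ℝ, (∀ o, (g o).IsHomogeneous 1) ∧ (∀ o, g o ≠ 0) ∧
      RingHom.ker (aeval g : MvPolynomial (Option Θ) ℝ →ₐ[ℝ] _) =
        Ideal.span {f | ∃ S ∈ 𝒮, f = ∑ θ ∈ S, X (some θ) - X none} := by
  choose c hc using hne
  let I : Ideal (MvPolynomial (Option Θ) ℝ) :=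
    Ideal.span {f | ∃ S ∈ 𝒮, f = ∑ θ ∈ S, X (some θ) - X none}
  let g : Option Θ → MvPolynomial (Option Θ) ℝ := fun o ↦ o.elim (X none) fun θ ↦
    if h : ∃ S, ∃ hS : S ∈ 𝒮, θ = c S hS then
      X none - ∑ η ∈ h.choose.erase θ, X (some η) else X (some θ)
  have hg1 (S : Finset Θ) (hS : S ∈ 𝒮) :
      g (some (c S hS)) = X none - ∑ η ∈ S.erase (c S hS), X (some η) := by
    have h : ∃ S', ∃ hS' : S' ∈ 𝒮, c S hS = c S' hS' := ⟨S, hS, rfl⟩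
    have hS' : h.choose = S := by
      obtain ⟨h1, h2⟩ := h.choose_spec
      exact hdisj _ h1 _ hS _ (hc _ h1) (h2 ▸ hc S hS)
    simp only [g, Option.elim_some, dif_pos h, hS']
  have hg2 (θ : Θ) (h : ¬ ∃ S, ∃ hS : S ∈ 𝒮, θ = c S hS) : g (some θ) = X (some θ) := by
    simp only [g, Option.elim_some, dif_neg h]
  have hsplit (S : Finset Θ) (hS : S ∈ 𝒮) (F : Θ → MvPolynomial (Option Θ) ℝ) :
      ∑ θ ∈ S, F θ = F (c S hS) + ∑ θ ∈ S.erase (c S hS), F θ :=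
    (Finset.add_sum_erase S F (hc S hS)).symm
  refine ⟨g, ?_, ?_, le_antisymm (fun f hf ↦ ?_) (Ideal.span_le.2 ?_)⟩
  · rintro (_ | θ)
    · exact isHomogeneous_X ℝ none
    · by_cases h : ∃ S, ∃ hS : S ∈ 𝒮, θ = c S hS
      · obtain ⟨S, hS, rfl⟩ := h
        rw [hg1]
        exact (isHomogeneous_X ℝ _).sub
          (IsHomogeneous.sum _ _ _ fun η _ ↦ isHomogeneous_X ℝ _)
      · rw [hg2 θ h]
        exact isHomogeneous_X ℝ _
  · rintro (_ | θ)
    · exact X_ne_zero _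
    · by_cases h : ∃ S, ∃ hS : S ∈ 𝒮, θ = c S hS
      · obtain ⟨S, hS, rfl⟩ := h
        rw [hg1]
        intro h0
        have := congrArg (eval fun o : Option Θ ↦ o.elim (1 : ℝ) fun _ ↦ 0) h0
        simp at this
      · rw [hg2 θ h]
        exact X_ne_zero _
  · change f ∈ I
    have hmk : (Ideal.Quotient.mkₐ ℝ I).comp (aeval g) = Ideal.Quotient.mkₐ ℝ I := by
      ext o
      rw [AlgHom.comp_apply, aeval_X, Ideal.Quotient.mkₐ_eq_mk, Ideal.Quotient.eq]
      obtain _ | θ := o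
      · exact (sub_self (X none : MvPolynomial (Option Θ) ℝ)).symm ▸ zero_mem I
      · by_cases h : ∃ S, ∃ hS : S ∈ 𝒮, θ = c S hS
        · obtain ⟨S, hS, rfl⟩ := h
          have hmem : ∑ θ ∈ S, X (some θ) - X none ∈ I := Ideal.subset_span ⟨S, hS, rfl⟩
          rw [hsplit S hS] at hmem
          rw [hg1]
          convert neg_mem hmem using 1
          ring
        · rw [hg2 θ h, sub_self]
          exact zero_mem I
    have h1 : Ideal.Quotient.mk I (aeval g f) = Ideal.Quotient.mk I f := DFunLike.congr_fun hmk f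
    rw [RingHom.mem_ker.1 hf, map_zero] at h1
    exact Ideal.Quotient.eq_zero_iff_mem.1 h1.symm
  · rintro _ ⟨S, hS, rfl⟩
    have hrest : ∑ θ ∈ S.erase (c S hS), g (some θ) = ∑ θ ∈ S.erase (c S hS), X (some θ) := by
      refine Finset.sum_congr rfl fun θ hθ ↦ hg2 θ ?_
      rintro ⟨S', hS', rfl⟩
      obtain ⟨h1, h2⟩ := Finset.mem_erase.1 hθ
      obtain rfl := hdisj _ hS' _ hS _ (hc _ hS') h2
      exact h1 rfl
    refine RingHom.mem_ker.2 ?_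
    rw [map_sub, map_sum, aeval_X]
    simp only [aeval_X]
    rw [hsplit S hS, hg1, hrest]
    simp [g]

namespace StagedTree

variable {Θ : Type} [DecidableEq Θ] (T : StagedTree Θ)

lemma nonempty_leaf : Nonempty T.Leaf := by
  have : Nonempty T.V := ⟨T.root⟩
  obtain ⟨v, hv⟩ := Finite.exists_max T.depthOf
  refine ⟨v, fun c ⟨hc, hcv⟩ ↦ ?_⟩
  have hspec : T.parent^[T.depthOf c] c = T.root := Nat.find_spec (T.reaches_root c)
  obtain ⟨n, hn⟩ : ∃ n, T.depthOf c = n + 1 :=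
    Nat.exists_eq_succ_of_ne_zero fun h ↦ hc (by rwa [h] at hspec)
  rw [hn, Function.iterate_succ_apply, hcv] at hspec
  have hle : T.depthOf v ≤ n := Nat.find_min' (T.reaches_root v) hspec
  have := hv c
  omega

lemma depthOf_le_depth (v : T.V) : T.depthOf v ≤ T.depth :=
  Finset.le_sup (f := T.depthOf) (Finset.mem_univ v)

lemma isHomogeneous_hpm (v : T.V) : (T.hpm v).IsHomogeneous T.depth := by
  have h1 : (∏ i ∈ Finset.range (T.depthOf v),
      (X (some (T.label (T.parent^[i] v))) : MvPolynomial (Option Θ) ℝ)).IsHomogeneous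
        (∑ _i ∈ Finset.range (T.depthOf v), 1) :=
    IsHomogeneous.prod _ _ _ fun i _ ↦ isHomogeneous_X ℝ _
  rw [Finset.sum_const, Finset.card_range, smul_eq_mul, mul_one] at h1
  have h2 := (isHomogeneous_X_pow (R := ℝ) (none : Option Θ) (T.depth - T.depthOf v)).mul h1
  rwa [Nat.sub_add_cancel (T.depthOf_le_depth v)] at h2

lemma hpm_eq_one_of_depth_eq_zero (h : T.depth = 0) (v : T.V) : T.hpm v = 1 := by
  have hv : T.depthOf v = 0 := Nat.le_zero.1 (h ▸ T.depthOf_le_depth v)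
  simp [hpm, h, hv]

/-- The set of labels of the edges going out of `v`. -/
def labelSet (v : T.V) : Finset Θ :=
  (Finset.univ.filter fun c ↦ T.IsChild v c).image T.label

lemma mem_labelSet {v : T.V} {θ : Θ} :
    θ ∈ T.labelSet v ↔ ∃ c, c ≠ T.root ∧ T.parent c = v ∧ T.label c = θ := by
  simp only [labelSet, Finset.mem_image, Finset.mem_filter, Finset.mem_univ, true_and]
  exact exists_congr fun c ↦ and_assoc

lemma sumIdeal_eq_span : T.sumIdeal = Ideal.span {f | ∃ S ∈ T.labelSet '' {v | ¬ T.IsLeaf v},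
    f = ∑ θ ∈ S, X (some θ) - X none} := by
  have hsum (v : T.V) : ∑ θ ∈ T.labelSet v, (X (some θ) : MvPolynomial (Option Θ) ℝ) =
      ∑ c ∈ Finset.univ.filter (fun c ↦ T.IsChild v c), X (some (T.label c)) := by
    refine Finset.sum_image fun a ha b hb hab ↦ ?_
    obtain ⟨ha0, hav⟩ := (Finset.mem_filter.1 ha).2
    obtain ⟨hb0, hbv⟩ := (Finset.mem_filter.1 hb).2
    exact T.label_inj a b ha0 hb0 (hav.trans hbv.symm) hab
  simp only [sumIdeal, Set.exists_mem_image, Set.mem_ofPred_eq, hsum]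

lemma exists_aeval_ker_eq_sumIdeal :
    ∃ g : Option Θ → MvPolynomial (Option Θ) ℝ, (∀ o, (g o).IsHomogeneous 1) ∧ (∀ o, g o ≠ 0) ∧
      RingHom.ker (aeval g : MvPolynomial (Option Θ) ℝ →ₐ[ℝ] _) = T.sumIdeal := by
  rw [sumIdeal_eq_span]
  apply exists_aeval_ker_eq_span_sum_sub
  · rintro _ ⟨v, hv, rfl⟩
    obtain ⟨c, hc⟩ := not_forall_not.1 hv
    exact ⟨T.label c, T.mem_labelSet.2 ⟨c, hc.1, hc.2, rfl⟩⟩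
  · rintro _ ⟨u, -, rfl⟩ _ ⟨v, -, rfl⟩ θ hu hv
    rw [mem_labelSet] at hu hv
    obtain h | h := T.stage_disjoint u v
    · ext η
      rw [mem_labelSet, mem_labelSet, h]
    · exact absurd ⟨hu, hv⟩ (h θ)

lemma hpm_notMem_sumIdeal (v : T.V) : T.hpm v ∉ T.sumIdeal := by
  obtain ⟨g, -, hg0, hker⟩ := T.exists_aeval_ker_eq_sumIdeal
  rw [← hker, RingHom.mem_ker, hpm, map_mul, map_pow, map_prod]
  simp only [aeval_X]
  exact mul_ne_zero (pow_ne_zero _ (hg0 _)) (Finset.prod_ne_zero_iff.2 fun _ _ ↦ hg0 _)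

lemma toric_iff_isToricFamily {A : Type*} [CommRing A] [Algebra ℝ A]
    (j : MvPolynomial (Option Θ) ℝ ⧸ T.sumIdeal →ₐ[ℝ] A) (hj : Function.Injective j) :
    T.Toric ↔ IsToricFamily fun l : T.Leaf ↦ j (Ideal.Quotient.mk T.sumIdeal (T.hpm l.1)) := by
  have hker : RingHom.ker T.phi.toRingHom = RingHom.ker
      (aeval fun l : T.Leaf ↦ j (Ideal.Quotient.mk T.sumIdeal (T.hpm l.1))) := by
    have hcomp : j.comp T.phi =
        aeval fun l : T.Leaf ↦ j (Ideal.Quotient.mk T.sumIdeal (T.hpm l.1)) := by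
      ext l
      simp [phi]
    rw [← hcomp]
    ext f
    exact (map_eq_zero_iff j hj).symm
  rw [Toric, IsToricFamily, hker]

lemma adjoin_range_eq_map_range_phi {A : Type*} [CommRing A] [Algebra ℝ A]
    (j : MvPolynomial (Option Θ) ℝ ⧸ T.sumIdeal →ₐ[ℝ] A) :
    Algebra.adjoin ℝ (Set.range fun l : T.Leaf ↦ j (Ideal.Quotient.mk T.sumIdeal (T.hpm l.1))) =
      T.phi.range.map j := by
  rw [phi, ← Algebra.adjoin_range_eq_range_aeval, AlgHom.map_adjoin, ← Set.range_comp]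
  rfl

lemma toric_of_depth_eq_zero (h : T.depth = 0) : T.Toric := by
  obtain ⟨g, -, -, hker⟩ := T.exists_aeval_ker_eq_sumIdeal
  have hone : (1 : MvPolynomial (Option Θ) ℝ) ∉ T.sumIdeal := by
    rw [← hker, RingHom.mem_ker, map_one]
    exact one_ne_zero
  have : Nontrivial (MvPolynomial (Option Θ) ℝ ⧸ T.sumIdeal) :=
    Ideal.Quotient.nontrivial_iff.2 ((Ideal.ne_top_iff_one _).2 hone)
  rw [T.toric_iff_isToricFamily (AlgHom.id ℝ _) Function.injective_id]
  simpa [T.hpm_eq_one_of_depth_eq_zero h] using isToricFamily_one (ι := T.Leaf)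

end StagedTree

namespace StagedTree

variable {Θ : Type} [DecidableEq Θ]

open MvPolynomial

/-- If the algebras `im φ_𝒯` and `im φ_𝒯'` are equal or differ only by a
permutation of the label variables (a bijection `e : Θ ≃ Θ`, extended by `z ↦ z`, carrying
the sum-to-one ideal of `𝒯` to that of `𝒯'` and `im φ_𝒯` onto `im φ_𝒯'`; the case of
equal algebras is `e = Equiv.refl Θ`), then `𝒯` and `𝒯'` are simultaneously toric or
non-toric. -/
theorem toric_iff_of_algebra_eq_up_to_permutation (T T' : StagedTree Θ)
    (e : Θ ≃ Θ)
    (hIdeal : T'.sumIdeal =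
      Ideal.map (renameEquiv ℝ (Equiv.optionCongr e) :
        MvPolynomial (Option Θ) ℝ →+* MvPolynomial (Option Θ) ℝ) T.sumIdeal)
    (hRange : Subalgebra.map
        (Ideal.quotientEquivAlg T.sumIdeal T'.sumIdeal
          (renameEquiv ℝ (Equiv.optionCongr e)) hIdeal).toAlgHom
        T.phi.range = T'.phi.range) :
    (T.Toric ↔ T'.Toric) := by
  obtain ⟨g, hg1, -, hker⟩ := T'.exists_aeval_ker_eq_sumIdeal
  let E := Ideal.quotientEquivAlg T.sumIdeal T'.sumIdeal
    (renameEquiv ℝ (Equiv.optionCongr e)) hIdeal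
  let j' : MvPolynomial (Option Θ) ℝ ⧸ T'.sumIdeal →ₐ[ℝ] MvPolynomial (Option Θ) ℝ :=
    Ideal.Quotient.liftₐ T'.sumIdeal (aeval g) fun f hf ↦ RingHom.mem_ker.1 (hker ▸ hf)
  have hj' : Function.Injective j' :=
    RingHom.lift_injective_of_ker_le_ideal T'.sumIdeal _ hker.le
  let j : MvPolynomial (Option Θ) ℝ ⧸ T.sumIdeal →ₐ[ℝ] MvPolynomial (Option Θ) ℝ :=
    j'.comp E.toAlgHom
  have hj : Function.Injective j := hj'.comp E.injective
  let x : T.Leaf → MvPolynomial (Option Θ) ℝ :=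
    fun l ↦ j (Ideal.Quotient.mk T.sumIdeal (T.hpm l.1))
  let x' : T'.Leaf → MvPolynomial (Option Θ) ℝ :=
    fun l ↦ j' (Ideal.Quotient.mk T'.sumIdeal (T'.hpm l.1))
  have hx (l : T.Leaf) : (x l).IsHomogeneous T.depth := by
    have h : (rename (Equiv.optionCongr e) (T.hpm l.1)).IsHomogeneous T.depth :=
      (T.isHomogeneous_hpm l.1).rename_isHomogeneous
    exact one_mul T.depth ▸ h.aeval g hg1
  have hx' (l : T'.Leaf) : (x' l).IsHomogeneous T'.depth := by
    exact one_mul T'.depth ▸ (T'.isHomogeneous_hpm l.1).aeval g hg1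
  have hx0 (l : T.Leaf) : x l ≠ 0 := fun h ↦ T.hpm_notMem_sumIdeal l.1
    (Ideal.Quotient.eq_zero_iff_mem.1 ((map_eq_zero_iff j hj).1 h))
  have hx0' (l : T'.Leaf) : x' l ≠ 0 := fun h ↦ T'.hpm_notMem_sumIdeal l.1
    (Ideal.Quotient.eq_zero_iff_mem.1 ((map_eq_zero_iff j' hj').1 h))
  have hadj : Algebra.adjoin ℝ (Set.range x) = Algebra.adjoin ℝ (Set.range x') := by
    rw [T.adjoin_range_eq_map_range_phi j, T'.adjoin_range_eq_map_range_phi j', ← hRange,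
      Subalgebra.map_map]
  have := T.nonempty_leaf
  have := T'.nonempty_leaf
  by_cases hd : T.depth = 0
  · have hd' : T'.depth = 0 :=
      eq_zero_of_adjoin_eq_of_isHomogeneous_zero (hd ▸ hx) hx' hx0' hadj
    exact iff_of_true (T.toric_of_depth_eq_zero hd) (T'.toric_of_depth_eq_zero hd')
  · have hd' : T'.depth ≠ 0 := fun h ↦
      hd (eq_zero_of_adjoin_eq_of_isHomogeneous_zero (h ▸ hx') hx hx0 hadj.symm)
    have hspan := (span_range_eq_of_adjoin_eq (Nat.pos_of_ne_zero hd) (Nat.pos_of_ne_zero hd')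
      hx hx0 hx' hx0' hadj).2
    rw [T.toric_iff_isToricFamily j hj, T'.toric_iff_isToricFamily j' hj',
      isToricFamily_iff_exists_basis (Nat.pos_of_ne_zero hd) hx hx0,
      isToricFamily_iff_exists_basis (Nat.pos_of_ne_zero hd') hx' hx0', hspan]

end StagedTree
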